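/- Let f : ℝ → ℝ be strictly positive and continuously differentiable, let μ ∈ ℝ and β > 0. Assume f^β is integrable, that x ↦ (x−μ) f'(x) f(x)^{β−1}, x ↦ h(x) f(x)^β and x ↦ h(x) k(x) f(x)^β are integrable, and that both (x−μ) f(x)^β → 0 and (x−μ) h(x) f(x)^β → 0 as x → ±∞. Then the covariance satisfies Cov_β(h(X), k(X)) := E_β[h·k] − E_β[h]·E_β[k] = 1/β². -/

import Mathlib

open MeasureTheory Filter

/-- `h = log f`. -/
noncomputable def hlog (f : ℝ → ℝ) : ℝ → ℝ := fun x => Real.log (f x)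

/-- `k(x) = (x−μ) h'(x)`. -/
noncomputable def kfun (f : ℝ → ℝ) (μ : ℝ) : ℝ → ℝ := fun x => (x - μ) * deriv (hlog f) x

/-- Tempered expectation `E_β[φ] = Z_β⁻¹ ∫ φ(x) f(x)^β dx`. -/
noncomputable def Eb (f : ℝ → ℝ) (β : ℝ) (φ : ℝ → ℝ) : ℝ :=
  (∫ x, φ x * f x ^ β) / (∫ x, f x ^ β)

lemma hasDerivAt_hlog {f : ℝ → ℝ} {x : ℝ} (hpos : 0 < f x) (hf : DifferentiableAt ℝ f x) :
    HasDerivAt (hlog f) (deriv f x / f x) x :=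
  hf.hasDerivAt.log hpos.ne'

lemma kfun_mul_rpow {f : ℝ → ℝ} {x : ℝ} (μ β : ℝ) (hpos : 0 < f x)
    (hf : DifferentiableAt ℝ f x) :
    kfun f μ x * f x ^ β = (x - μ) * deriv f x * f x ^ (β - 1) := by
  rw [kfun, (hasDerivAt_hlog hpos hf).deriv, Real.rpow_sub_one hpos.ne']
  ring

lemma hasDerivAt_sub_mul_rpow {f : ℝ → ℝ} {x : ℝ} (μ β : ℝ) (hpos : 0 < f x)
    (hf : DifferentiableAt ℝ f x) :
    HasDerivAt (fun x => (x - μ) * f x ^ β) (f x ^ β + β * (kfun f μ x * f x ^ β)) x := by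
  refine (((hasDerivAt_id x).sub_const μ).mul
    (hf.hasDerivAt.rpow_const (p := β) (Or.inl hpos.ne'))).congr_deriv ?_
  rw [kfun_mul_rpow μ β hpos hf]
  simp only [id]
  ring

lemma hasDerivAt_sub_mul_hlog_mul_rpow {f : ℝ → ℝ} {x : ℝ} (μ β : ℝ) (hpos : 0 < f x)
    (hf : DifferentiableAt ℝ f x) :
    HasDerivAt (fun x => (x - μ) * hlog f x * f x ^ β)
      (hlog f x * f x ^ β + kfun f μ x * f x ^ β
        + β * (hlog f x * kfun f μ x * f x ^ β)) x := by
  have h := (hasDerivAt_hlog hpos hf).mul (hasDerivAt_sub_mul_rpow μ β hpos hf)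
  refine (h.congr_of_eventuallyEq (.of_forall fun y => ?_)).congr_deriv ?_
  · simp only [Pi.mul_apply]
    ring
  · simp only [kfun, (hasDerivAt_hlog hpos hf).deriv]
    ring

/-- `V(β) = Cov_β(h, k) = E_β[h·k] − E_β[h]·E_β[k] = 1/β²`. -/
theorem tempered_cov_h_k
    (f : ℝ → ℝ) (hf_pos : ∀ x, 0 < f x) (hf : ContDiff ℝ 1 f)
    (μ β : ℝ) (hβ : 0 < β)
    (h1 : Integrable (fun x => f x ^ β))
    (h2 : Integrable (fun x => (x - μ) * deriv f x * f x ^ (β - 1)))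
    (h3 : Integrable (fun x => hlog f x * f x ^ β))
    (h4 : Integrable (fun x => hlog f x * kfun f μ x * f x ^ β))
    (htop1 : Tendsto (fun x => (x - μ) * f x ^ β) atTop (nhds 0))
    (hbot1 : Tendsto (fun x => (x - μ) * f x ^ β) atBot (nhds 0))
    (htop2 : Tendsto (fun x => (x - μ) * hlog f x * f x ^ β) atTop (nhds 0))
    (hbot2 : Tendsto (fun x => (x - μ) * hlog f x * f x ^ β) atBot (nhds 0)) :
    Eb f β (fun x => hlog f x * kfun f μ x) - Eb f β (hlog f) * Eb f β (kfun f μ)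
      = 1 / β ^ 2 := by
  have hd : Differentiable ℝ f := hf.differentiable (by norm_num)
  have hk : Integrable (fun x => kfun f μ x * f x ^ β) :=
    h2.congr (.of_forall fun x => (kfun_mul_rpow μ β (hf_pos x) (hd x)).symm)
  have e1 := integral_of_hasDerivAt_of_tendsto
    (fun x => hasDerivAt_sub_mul_rpow μ β (hf_pos x) (hd x))
    (h1.add (hk.const_mul β)) hbot1 htop1
  have e2 := integral_of_hasDerivAt_of_tendsto
    (fun x => hasDerivAt_sub_mul_hlog_mul_rpow μ β (hf_pos x) (hd x))
    ((h3.add hk).add (h4.const_mul β)) hbot2 htop2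
  rw [integral_add h1 (hk.const_mul β), integral_const_mul, sub_zero] at e1
  rw [integral_add (by exact h3.add hk) (h4.const_mul β), integral_const_mul,
    integral_add h3 hk, sub_zero] at e2
  have hZ : 0 < ∫ x, f x ^ β := by
    rw [integral_pos_iff_support_of_nonneg (fun x => (Real.rpow_pos_of_pos (hf_pos x) β).le) h1,
      Function.support_eq_univ fun x => (Real.rpow_pos_of_pos (hf_pos x) β).ne']
    simp
  simp only [Eb]
  generalize (∫ x, f x ^ β) = Z at *
  generalize (∫ x, kfun f μ x * f x ^ β) = K at *
  generalize (∫ x, hlog f x * f x ^ β) = H at *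
  generalize (∫ x, hlog f x * kfun f μ x * f x ^ β) = M at *
  obtain rfl : Z = -(β * K) := by linarith
  obtain rfl : H = -K - β * M := by linarith
  have hK : K ≠ 0 := by
    rintro rfl
    simp at hZ
  field_simp
  ring
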